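/- Let $E : \mathbb{R} \to \mathbb{R}$ be even with support in $[-1,1]$, $E(0)=1$, absolutely continuous with $E'$ of bounded variation. For $\lambda > 0$ and complex $z$ with $0 < \mathrm{Re}\, z < 1$, define $M^\lambda(z) = \frac{1}{\pi}\int_0^\infty \hat E^\lambda(t)\, t^{-z}\, dt$, where $\hat E^\lambda(t) = \int_{-\infty}^{\infty} E(\nu/\lambda) e^{-i\nu t} d\nu$. Then $M^\lambda(z) = \frac{2}{\pi}\lambda^z \Gamma(1-z)\sin(\pi z/2)\int_0^1 E(\nu)\nu^{z-1}\, d\nu$. -/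

import Mathlib

open MeasureTheory
open Set Filter Topology

theorem integrableOn_cpow_mul_exp_neg_mul_Ioi {a r : ℂ} (ha : 0 < a.re) (hr : 0 < r.re) :
    IntegrableOn (fun t : ℝ => (t : ℂ) ^ (a - 1) * Complex.exp (-(r * t))) (Ioi 0) := by
  have h := integrableOn_rpow_mul_exp_neg_mul_rpow (s := a.re - 1) (by linarith) one_pos hr
  refine Integrable.mono' h ?_ ?_
  · refine ContinuousOn.aestronglyMeasurable (fun t ht => ?_) measurableSet_Ioi
    refine ContinuousAt.continuousWithinAt (ContinuousAt.mul ?_ (by fun_prop))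
    exact Complex.continuousAt_ofReal_cpow_const _ _ (Or.inr (ne_of_gt ht))
  · refine (ae_restrict_iff' measurableSet_Ioi).mpr (ae_of_all _ fun t ht => ?_)
    rw [norm_mul, Complex.norm_cpow_eq_rpow_re_of_pos ht, Complex.norm_exp]
    simp

theorem hasDerivAt_integral_cpow_mul_exp_neg_mul_Ioi {a r : ℂ} (ha : 0 < a.re) (hr : 0 < r.re) :
    HasDerivAt (fun w : ℂ => ∫ t in Ioi (0 : ℝ), (t : ℂ) ^ (a - 1) * Complex.exp (-(w * t)))
      (∫ t in Ioi (0 : ℝ), (t : ℂ) ^ (a - 1) * (Complex.exp (-(r * t)) * -(t : ℂ))) r := by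
  have hopen : IsOpen {w : ℂ | r.re / 2 < w.re} := isOpen_lt continuous_const Complex.continuous_re
  have hmem : {w : ℂ | r.re / 2 < w.re} ∈ 𝓝 r := hopen.mem_nhds (by simpa using hr)
  have hcont (w : ℂ) : AEStronglyMeasurable
      (fun t : ℝ => (t : ℂ) ^ (a - 1) * (Complex.exp (-(w * t)) * -(t : ℂ)))
      (volume.restrict (Ioi 0)) := by
    refine ContinuousOn.aestronglyMeasurable (fun t ht => ?_) measurableSet_Ioi
    refine ContinuousAt.continuousWithinAt (ContinuousAt.mul ?_ (by fun_prop))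
    exact Complex.continuousAt_ofReal_cpow_const _ _ (Or.inr (ne_of_gt ht))
  refine (hasDerivAt_integral_of_dominated_loc_of_deriv_le (𝕜 := ℂ) (μ := volume.restrict (Ioi 0))
    (F := fun w t => (t : ℂ) ^ (a - 1) * Complex.exp (-(w * (t : ℝ))))
    (F' := fun w t => (t : ℂ) ^ (a - 1) * (Complex.exp (-(w * t)) * -(t : ℂ)))
    (bound := fun t : ℝ => t ^ a.re * Real.exp (-(r.re / 2) * t ^ (1 : ℝ))) hmem ?_
    (integrableOn_cpow_mul_exp_neg_mul_Ioi ha hr) (hcont r) ?_ ?_ ?_).2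
  · filter_upwards [hmem] with w hw
    exact (integrableOn_cpow_mul_exp_neg_mul_Ioi ha
      (lt_trans (by positivity) hw : 0 < w.re)).aestronglyMeasurable
  · refine (ae_restrict_iff' measurableSet_Ioi).mpr (ae_of_all _ fun t (ht : 0 < t) w hw => ?_)
    rw [norm_mul, norm_mul, Complex.norm_cpow_eq_rpow_re_of_pos ht, Complex.norm_exp, norm_neg,
      Complex.norm_of_nonneg ht.le, mul_comm (Real.exp _), ← mul_assoc, Complex.sub_re,
      Complex.one_re, ← Real.rpow_add_one ht.ne', sub_add_cancel, Real.rpow_one]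
    simp only [mem_ofPred_eq] at hw
    gcongr
    simp
    nlinarith
  · exact integrableOn_rpow_mul_exp_neg_mul_rpow (by linarith) one_pos (by positivity)
  · refine ae_of_all _ fun t w _ => ?_
    have : HasDerivAt (fun w : ℂ => -(w * t)) (-(t : ℂ)) w :=
      (hasDerivAt_mul_const (t : ℂ)).fun_neg
    exact this.cexp.const_mul _

/-- Complex-parameter version of `Complex.integral_cpow_mul_exp_neg_mul_Ioi`. -/
theorem integral_cpow_mul_exp_neg_mul_Ioi_of_re_pos {a r : ℂ} (ha : 0 < a.re) (hr : 0 < r.re) :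
    ∫ t in Ioi (0 : ℝ), (t : ℂ) ^ (a - 1) * Complex.exp (-(r * t))
      = (1 / r) ^ a * Complex.Gamma a := by
  have hopen : IsOpen {w : ℂ | 0 < w.re} := isOpen_lt continuous_const Complex.continuous_re
  have hL : AnalyticOnNhd ℂ (fun w : ℂ => ∫ t in Ioi (0 : ℝ),
      (t : ℂ) ^ (a - 1) * Complex.exp (-(w * t))) {w : ℂ | 0 < w.re} :=
    DifferentiableOn.analyticOnNhd (fun w hw =>
      (hasDerivAt_integral_cpow_mul_exp_neg_mul_Ioi ha
        hw).differentiableAt.differentiableWithinAt) hopen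
  have hR : AnalyticOnNhd ℂ (fun w : ℂ => (1 / w) ^ a * Complex.Gamma a) {w : ℂ | 0 < w.re} := by
    refine DifferentiableOn.analyticOnNhd (fun w (hw : 0 < w.re) => ?_) hopen
    have hw0 : w ≠ 0 := by rintro rfl; simp at hw
    refine DifferentiableAt.differentiableWithinAt (DifferentiableAt.mul_const ?_ _)
    refine DifferentiableAt.cpow_const ?_ ?_
    · exact (differentiableAt_const _).div differentiableAt_id hw0
    · left
      rw [one_div, Complex.inv_re]
      exact div_pos hw (Complex.normSq_pos.mpr hw0)
  refine hL.eqOn_of_preconnected_of_frequently_eq hR (convex_halfSpace_re_gt 0).isPreconnected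
    (z₀ := 1) (by simp) ?_ hr
  have h_real : ∃ᶠ x : ℝ in 𝓝[≠] (1 : ℝ), ∫ t in Ioi (0 : ℝ),
      (t : ℂ) ^ (a - 1) * Complex.exp (-((x : ℂ) * t)) = (1 / (x : ℂ)) ^ a * Complex.Gamma a := by
    refine Eventually.frequently ?_
    filter_upwards [nhdsWithin_le_nhds (lt_mem_nhds one_pos)] with x hx
    exact Complex.integral_cpow_mul_exp_neg_mul_Ioi ha hx
  refine Tendsto.frequently (f := fun x : ℝ => (x : ℂ)) ?_ h_real
  refine tendsto_nhdsWithin_of_tendsto_nhds_of_eventually_within _ ?_ ?_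
  · simpa using (Complex.continuous_ofReal.tendsto 1).mono_left nhdsWithin_le_nhds
  · filter_upwards [self_mem_nhdsWithin] with x hx
    simpa using hx

theorem abs_integral_mul_deriv_le_of_absolutelyContinuous {f h : ℝ → ℝ} {a b C : ℝ} (hab : a ≤ b)
    (hf : AbsolutelyContinuousOnInterval f a b) (hfa : f a = 0) (hfb : f b = 0)
    (hh : ContDiff ℝ 1 h) (hC : ∀ x, |h x| ≤ C) :
    |∫ x in a..b, f x * deriv h x| ≤ C * ∫ x in a..b, |deriv f x| := by
  have hh' : AbsolutelyContinuousOnInterval h a b := hh.contDiffOn.absolutelyContinuousOnInterval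
  rw [hf.integral_mul_deriv_eq_deriv_mul hh', hfa, hfb,
    zero_mul, zero_mul, sub_zero, zero_sub, abs_neg, ← intervalIntegral.integral_const_mul]
  refine intervalIntegral.norm_integral_le_of_norm_le (E := ℝ) hab (ae_of_all _ fun x _ => ?_)
    ((hf.intervalIntegrable_deriv.abs).const_mul C)
  rw [Real.norm_eq_abs, abs_mul, mul_comm]
  exact mul_le_mul_of_nonneg_right (hC x) (abs_nonneg _)

theorem norm_integral_mul_cexp_le_of_absolutelyContinuous {f : ℝ → ℝ} {a b : ℝ} (hab : a ≤ b)
    (hf : AbsolutelyContinuousOnInterval f a b) (hfa : f a = 0) (hfb : f b = 0)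
    (hsupp : Function.support f ⊆ Ioc a b) {t : ℝ} (ht : 0 < t) :
    ‖∫ ν : ℝ, (f ν : ℂ) * Complex.exp (-(Complex.I * ν * t))‖
      ≤ (2 * ∫ x in a..b, |deriv f x|) / t := by
  have hsin : |∫ ν in a..b, f ν * Real.cos (ν * t)| ≤ t⁻¹ * ∫ x in a..b, |deriv f x| := by
    have hd (x : ℝ) : deriv (fun ν => t⁻¹ * Real.sin (ν * t)) x = Real.cos (x * t) := by
      have := (((hasDerivAt_id x).mul_const t).sin.const_mul t⁻¹).deriv
      simp only [id] at this
      rw [this]; field_simp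
    have := abs_integral_mul_deriv_le_of_absolutelyContinuous (h := fun ν => t⁻¹ * Real.sin (ν * t))
      (C := t⁻¹) hab hf hfa hfb (by fun_prop) fun x => by
        rw [abs_mul, abs_of_pos (inv_pos.mpr ht)]
        exact mul_le_of_le_one_right (by positivity) (Real.abs_sin_le_one _)
    simpa only [hd] using this
  have hcos : |∫ ν in a..b, f ν * Real.sin (ν * t)| ≤ t⁻¹ * ∫ x in a..b, |deriv f x| := by
    have hd (x : ℝ) : deriv (fun ν => -t⁻¹ * Real.cos (ν * t)) x = Real.sin (x * t) := by
      have := (((hasDerivAt_id x).mul_const t).cos.const_mul (-t⁻¹)).deriv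
      simp only [id] at this
      rw [this]; field_simp
    have := abs_integral_mul_deriv_le_of_absolutelyContinuous
      (h := fun ν => -t⁻¹ * Real.cos (ν * t)) (C := t⁻¹) hab hf hfa hfb (by fun_prop) fun x => by
        rw [abs_mul, abs_neg, abs_of_pos (inv_pos.mpr ht)]
        exact mul_le_of_le_one_right (by positivity) (Real.abs_cos_le_one _)
    simpa only [hd] using this
  have hint {u : ℝ → ℝ} (hu : Continuous u) :
      IntervalIntegrable (fun ν => ((f ν * u ν : ℝ) : ℂ)) volume a b := by
    refine ContinuousOn.intervalIntegrable ?_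
    exact Complex.continuous_ofReal.comp_continuousOn (hf.continuousOn.mul hu.continuousOn)
  have hsplit : ∫ ν : ℝ, (f ν : ℂ) * Complex.exp (-(Complex.I * ν * t))
      = ((∫ ν in a..b, f ν * Real.cos (ν * t) : ℝ) : ℂ)
        - Complex.I * ((∫ ν in a..b, f ν * Real.sin (ν * t) : ℝ) : ℂ) := by
    rw [← intervalIntegral.integral_ofReal, ← intervalIntegral.integral_ofReal,
      ← intervalIntegral.integral_const_mul,
      ← intervalIntegral.integral_sub (hint (by fun_prop)) ((hint (by fun_prop)).const_mul _),
      ← intervalIntegral.integral_eq_integral_of_support_subset]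
    · refine intervalIntegral.integral_congr fun ν _ => ?_
      have : -(Complex.I * ν * t) = ((-(ν * t) : ℝ) : ℂ) * Complex.I := by push_cast; ring
      simp only [this, Complex.exp_mul_I, ← Complex.ofReal_cos, ← Complex.ofReal_sin,
        Real.cos_neg, Real.sin_neg]
      push_cast
      ring
    · refine Subset.trans (fun ν hν => ?_) hsupp
      contrapose! hν
      simp [Function.notMem_support.mp (by simpa using hν)]
  rw [hsplit]
  refine (norm_sub_le _ _).trans ?_
  rw [norm_mul, Complex.norm_I, one_mul, Complex.norm_real, Complex.norm_real, Real.norm_eq_abs,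
    Real.norm_eq_abs]
  refine (add_le_add hsin hcos).trans (le_of_eq ?_)
  field_simp; ring

theorem one_div_I_mul_cpow {ν : ℝ} (hν : 0 < ν) (s : ℂ) :
    (1 / (Complex.I * ν)) ^ s = (ν : ℂ) ^ (-s) * Complex.exp (-(Real.pi / 2 * s) * Complex.I) := by
  have h : 1 / (Complex.I * ν) = ((ν⁻¹ : ℝ) : ℂ) * -Complex.I := by
    rw [one_div, mul_inv, Complex.inv_I, Complex.ofReal_inv, mul_comm]
  have hν0 : (ν : ℂ) ≠ 0 := by exact_mod_cast hν.ne'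
  rw [h, Complex.cpow_def_of_ne_zero (by simp [hν.ne']), Complex.cpow_def_of_ne_zero hν0,
    Complex.log_ofReal_mul (inv_pos.mpr hν) (by simp), Complex.log_neg_I, ← Complex.exp_add,
    Real.log_inv, ← Complex.ofReal_log hν.le]
  congr 1
  push_cast
  ring

theorem one_div_I_mul_neg_cpow {ν : ℝ} (hν : 0 < ν) (s : ℂ) :
    (1 / (Complex.I * (-ν : ℝ))) ^ s
      = (ν : ℂ) ^ (-s) * Complex.exp (Real.pi / 2 * s * Complex.I) := by
  have h : 1 / (Complex.I * (-ν : ℝ)) = ((ν⁻¹ : ℝ) : ℂ) * Complex.I := by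
    rw [one_div, mul_inv, Complex.inv_I, Complex.ofReal_inv, Complex.ofReal_neg, inv_neg]
    ring
  have hν0 : (ν : ℂ) ≠ 0 := by exact_mod_cast hν.ne'
  rw [h, Complex.cpow_def_of_ne_zero (by simp [hν.ne']), Complex.cpow_def_of_ne_zero hν0,
    Complex.log_ofReal_mul (inv_pos.mpr hν) (by simp), Complex.log_I, ← Complex.exp_add,
    Real.log_inv, ← Complex.ofReal_log hν.le]
  congr 1
  push_cast
  ring

theorem norm_one_div_add_I_mul_cpow_le {ε ν : ℝ} (hν : ν ≠ 0) {s : ℂ} (hs : 0 ≤ s.re) :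
    ‖(1 / (ε + Complex.I * ν)) ^ s‖ ≤ Real.exp (Real.pi * |s.im|) * ‖ν‖ ^ (-s.re) := by
  have hle : |ν| ≤ ‖(ε + Complex.I * ν : ℂ)‖ := by
    simpa using Complex.abs_im_le_norm (ε + Complex.I * ν : ℂ)
  have hν' : 0 < |ν| := abs_pos.mpr hν
  refine (Complex.norm_cpow_le _ _).trans ?_
  rw [div_eq_mul_inv, ← Real.exp_neg, mul_comm]
  gcongr
  · rw [← mul_neg]
    refine (le_abs_self _).trans ?_
    rw [abs_mul, abs_neg]
    gcongr
    exact Complex.abs_arg_le_pi _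
  · rw [norm_div, norm_one, one_div, Real.inv_rpow (norm_nonneg _), ← Real.rpow_neg (norm_nonneg _),
      Real.norm_eq_abs]
    exact Real.rpow_le_rpow_of_nonpos hν' hle (by linarith)

theorem integrable_norm_rpow_mul_norm {f : ℝ → ℂ} (hf : Continuous f) (hc : HasCompactSupport f)
    {α : ℝ} (hα : α < 1) : Integrable fun ν : ℝ => ‖ν‖ ^ (-α) * ‖f ν‖ := by
  have hm : Measurable fun ν : ℝ => ‖ν‖ ^ (-α) := by fun_prop
  have : LocallyIntegrable (fun ν : ℝ => ‖ν‖ ^ (-α)) volume := by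
    refine locallyIntegrable_of_norm_le_rpow (C := 1) (α := α) (by simp) (by simpa using hα)
      (ae_of_all _ fun ν => ?_) hm.aestronglyMeasurable
    rw [one_mul, Real.norm_of_nonneg (by positivity)]
  exact this.integrable_smul_right_of_hasCompactSupport hf.norm hc.norm

theorem integral_ofReal_mul_cpow_I_mul {f : ℝ → ℂ} (hf : Continuous f) (hc : HasCompactSupport f)
    (heven : ∀ ν, f (-ν) = f ν) {z : ℂ} (hz1 : 0 < z.re) (hz2 : z.re < 1) :
    ∫ ν : ℝ, f ν * (1 / (Complex.I * ν)) ^ (1 - z)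
      = 2 * Complex.sin (Real.pi * z / 2) * ∫ ν in Ioi (0 : ℝ), f ν * (ν : ℂ) ^ (z - 1) := by
  have hint : Integrable fun ν : ℝ => f ν * (1 / (Complex.I * ν)) ^ (1 - z) := by
    refine Integrable.mono' ((integrable_norm_rpow_mul_norm hf hc
      (α := 1 - z.re) (by linarith)).const_mul (Real.exp (Real.pi * |(1 - z).im|))) ?_ ?_
    · exact (hf.measurable.mul (by fun_prop)).aestronglyMeasurable
    · filter_upwards [Measure.ae_ne volume (0 : ℝ)] with ν hν
      have := norm_one_div_add_I_mul_cpow_le (ε := 0) hν (s := 1 - z) (by simp; linarith)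
      rw [Complex.ofReal_zero, zero_add] at this
      rw [norm_mul, mul_comm, ← mul_assoc]
      exact mul_le_mul_of_nonneg_right this (norm_nonneg _)
  rw [← intervalIntegral.integral_Iic_add_Ioi (b := 0) hint.integrableOn hint.integrableOn,
    ← neg_zero, ← integral_comp_neg_Ioi, neg_zero,
    ← integral_add (hint.comp_neg.integrableOn) hint.integrableOn,
    ← integral_const_mul]
  refine setIntegral_congr_fun measurableSet_Ioi fun ν hν => ?_
  have hsin : Complex.sin (Real.pi * z / 2) = Complex.cos (Real.pi / 2 * (1 - z)) := by
    rw [← Complex.cos_pi_div_two_sub]; congr 1; ring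
  rw [one_div_I_mul_neg_cpow hν, one_div_I_mul_cpow hν, heven, hsin, Complex.cos, neg_sub]
  ring

theorem integral_fourier_mul_cpow_mul_exp {f : ℝ → ℂ} (hf : Integrable f) {z : ℂ}
    (hz2 : z.re < 1) {ε : ℝ} (hε : 0 < ε) :
    ∫ t in Ioi (0 : ℝ), (∫ ν : ℝ, f ν * Complex.exp (-(Complex.I * ν * t))) * (t : ℂ) ^ (-z)
        * Complex.exp (-(ε * t))
      = (∫ ν : ℝ, f ν * (1 / (ε + Complex.I * ν)) ^ (1 - z)) * Complex.Gamma (1 - z) := by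
  have hs : 0 < (1 - z).re := by simpa using hz2
  have hprod : Integrable (Function.uncurry fun t ν : ℝ => Complex.exp (-(Complex.I * ν * t))
      * (((t : ℂ) ^ (1 - z - 1) * Complex.exp (-(ε * t))) * f ν))
      ((volume.restrict (Ioi 0)).prod volume) := by
    refine Integrable.bdd_mul (c := 1) ((integrableOn_cpow_mul_exp_neg_mul_Ioi hs
      (r := (ε : ℂ)) (by simpa using hε)).mul_prod hf) ?_ (ae_of_all _ fun p => ?_)
    · exact Continuous.aestronglyMeasurable (by fun_prop)
    · rw [Complex.norm_exp]; simp
  calc _ = ∫ t in Ioi (0 : ℝ), ∫ ν : ℝ, Complex.exp (-(Complex.I * ν * t))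
      * (((t : ℂ) ^ (1 - z - 1) * Complex.exp (-(ε * t))) * f ν) := by
        refine integral_congr_ae (ae_of_all _ fun t => ?_)
        simp only []
        rw [mul_assoc, ← integral_mul_const]
        refine integral_congr_ae (ae_of_all _ fun ν => ?_)
        simp only [show 1 - z - 1 = -z by ring]
        ring
    _ = ∫ ν : ℝ, ∫ t in Ioi (0 : ℝ), Complex.exp (-(Complex.I * ν * t))
      * (((t : ℂ) ^ (1 - z - 1) * Complex.exp (-(ε * t))) * f ν) := integral_integral_swap hprod
    _ = _ := by
        rw [← integral_mul_const]
        refine integral_congr_ae (ae_of_all _ fun ν => ?_)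
        simp only []
        rw [mul_assoc, ← integral_cpow_mul_exp_neg_mul_Ioi_of_re_pos hs (r := ε + Complex.I * ν)
          (by simpa using hε), ← integral_const_mul]
        refine integral_congr_ae (ae_of_all _ fun t => ?_)
        simp only [add_mul, neg_add, Complex.exp_add]
        ring

theorem tendsto_integral_mul_one_div_add_I_mul_cpow {f : ℝ → ℂ} (hf : Continuous f)
    (hc : HasCompactSupport f) {s : ℂ} (hs0 : 0 ≤ s.re) (hs1 : s.re < 1) :
    Tendsto (fun ε : ℝ => ∫ ν : ℝ, f ν * (1 / (ε + Complex.I * ν)) ^ s) (𝓝[>] 0)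
      (𝓝 (∫ ν : ℝ, f ν * (1 / (Complex.I * ν)) ^ s)) := by
  refine tendsto_integral_filter_of_dominated_convergence _ (Eventually.of_forall fun ε => ?_)
    (Eventually.of_forall fun ε => ?_) ((integrable_norm_rpow_mul_norm hf hc hs1).const_mul
      (Real.exp (Real.pi * |s.im|))) ?_
  · exact (hf.measurable.mul (by fun_prop)).aestronglyMeasurable
  · filter_upwards [Measure.ae_ne volume (0 : ℝ)] with ν hν
    rw [norm_mul, mul_comm, ← mul_assoc]
    exact mul_le_mul_of_nonneg_right (norm_one_div_add_I_mul_cpow_le hν hs0) (norm_nonneg _)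
  · filter_upwards [Measure.ae_ne volume (0 : ℝ)] with ν hν
    have hI : Complex.I * ν ≠ 0 := by simp [hν]
    have hcont : ContinuousAt (fun ε : ℝ => f ν * (1 / (ε + Complex.I * ν)) ^ s) 0 := by
      refine continuousAt_const.mul (ContinuousAt.cpow ?_ continuousAt_const ?_)
      · exact ContinuousAt.div (by fun_prop) (by fun_prop) (by simpa using hν)
      · right
        simp [Complex.inv_im, hν]
    simpa using hcont.tendsto.mono_left nhdsWithin_le_nhds

theorem integrableOn_fourier_mul_cpow {f : ℝ → ℂ} (hf : Integrable f) {C : ℝ}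
    (hC : ∀ t : ℝ, 0 < t → ‖∫ ν : ℝ, f ν * Complex.exp (-(Complex.I * ν * t))‖ ≤ C / t)
    {z : ℂ} (hz1 : 0 < z.re) (hz2 : z.re < 1) :
    IntegrableOn (fun t : ℝ => (∫ ν : ℝ, f ν * Complex.exp (-(Complex.I * ν * t)))
      * (t : ℂ) ^ (-z)) (Ioi 0) := by
  have hnorm (t ν : ℝ) : ‖f ν * Complex.exp (-(Complex.I * ν * t))‖ = ‖f ν‖ := by
    rw [norm_mul, Complex.norm_exp]; simp
  have hcont : Continuous fun t : ℝ => ∫ ν : ℝ, f ν * Complex.exp (-(Complex.I * ν * t)) :=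
    continuous_of_dominated
      (fun t => hf.aestronglyMeasurable.mul (Continuous.aestronglyMeasurable (by fun_prop)))
      (fun t => ae_of_all _ fun ν => (hnorm t ν).le) hf.norm
      (ae_of_all _ fun ν => by fun_prop)
  have hmellin : MellinConvergent
      (fun t : ℝ => ∫ ν : ℝ, f ν * Complex.exp (-(Complex.I * ν * t))) (1 - z) := by
    refine mellinConvergent_of_isBigO_rpow (a := 1) (b := 0)
      (hcont.locallyIntegrable.locallyIntegrableOn _) ?_ (by simpa using hz1) ?_
      (by simpa using hz2)
    · refine Asymptotics.IsBigO.of_bound C ?_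
      filter_upwards [eventually_gt_atTop 0] with t ht
      refine (hC t ht).trans (le_of_eq ?_)
      rw [Real.norm_of_nonneg (by positivity), Real.rpow_neg_one, div_eq_mul_inv]
    · refine Asymptotics.IsBigO.of_bound (∫ ν, ‖f ν‖) (Eventually.of_forall fun t => ?_)
      rw [neg_zero, Real.rpow_zero, norm_one, mul_one]
      refine (norm_integral_le_integral_norm _).trans (le_of_eq ?_)
      simp only [hnorm]
  refine hmellin.congr_fun (fun t _ => ?_) measurableSet_Ioi
  simp only [smul_eq_mul, show 1 - z - 1 = -z by ring]
  ring

theorem integral_fourier_mul_cpow {f : ℝ → ℂ} (hf : Continuous f) (hc : HasCompactSupport f)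
    (heven : ∀ ν, f (-ν) = f ν) {C : ℝ}
    (hC : ∀ t : ℝ, 0 < t → ‖∫ ν : ℝ, f ν * Complex.exp (-(Complex.I * ν * t))‖ ≤ C / t)
    {z : ℂ} (hz1 : 0 < z.re) (hz2 : z.re < 1) :
    ∫ t in Ioi (0 : ℝ), (∫ ν : ℝ, f ν * Complex.exp (-(Complex.I * ν * t))) * (t : ℂ) ^ (-z)
      = 2 * Complex.Gamma (1 - z) * Complex.sin (Real.pi * z / 2)
        * ∫ ν in Ioi (0 : ℝ), f ν * (ν : ℂ) ^ (z - 1) := by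
  have hfi : Integrable f := hf.integrable_of_hasCompactSupport hc
  have hint := integrableOn_fourier_mul_cpow hfi hC hz1 hz2
  have hleft : Tendsto (fun ε : ℝ => ∫ t in Ioi (0 : ℝ),
      (∫ ν : ℝ, f ν * Complex.exp (-(Complex.I * ν * t))) * (t : ℂ) ^ (-z)
        * Complex.exp (-(ε * t))) (𝓝[>] 0) (𝓝 (∫ t in Ioi (0 : ℝ),
      (∫ ν : ℝ, f ν * Complex.exp (-(Complex.I * ν * t))) * (t : ℂ) ^ (-z))) := by
    refine tendsto_integral_filter_of_dominated_convergence _ (Eventually.of_forall fun ε => ?_)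
      ?_ hint.norm (ae_of_all _ fun t => ?_)
    · exact hint.aestronglyMeasurable.mul (Continuous.aestronglyMeasurable (by fun_prop))
    · filter_upwards [self_mem_nhdsWithin] with ε (hε : 0 < ε)
      refine (ae_restrict_iff' measurableSet_Ioi).mpr (ae_of_all _ fun t (ht : 0 < t) => ?_)
      rw [norm_mul]
      refine mul_le_of_le_one_right (norm_nonneg _) ?_
      rw [Complex.norm_exp, Real.exp_le_one_iff]
      simp
      positivity
    · have hcont : Continuous fun ε : ℝ =>
          (∫ ν : ℝ, f ν * Complex.exp (-(Complex.I * ν * t))) * (t : ℂ) ^ (-z)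
            * Complex.exp (-(ε * t)) := by fun_prop
      simpa using (hcont.tendsto 0).mono_left nhdsWithin_le_nhds
  have hright := (tendsto_integral_mul_one_div_add_I_mul_cpow hf hc (s := 1 - z)
    (by simpa using hz2.le) (by simpa using hz1)).mul_const (Complex.Gamma (1 - z))
  rw [integral_ofReal_mul_cpow_I_mul hf hc heven hz1 hz2] at hright
  rw [tendsto_nhds_unique_of_eventuallyEq hleft hright ?_]
  · ring
  · filter_upwards [self_mem_nhdsWithin] with ε hε
    exact integral_fourier_mul_cpow_mul_exp hfi hz2 hε

theorem stmt_12 (E g : ℝ → ℝ)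
    (hEven : ∀ ν : ℝ, E (-ν) = E ν)
    (hSupp : Function.support E ⊆ Set.Icc (-1) 1)
    (hE0 : E 0 = 1)
    (hg : MeasureTheory.Integrable g)
    (hAC : ∀ x : ℝ, E x = E 0 + ∫ t in (0 : ℝ)..x, g t)
    (hBV : BoundedVariationOn g Set.univ)
    (lam : ℝ) (hlam : 0 < lam) (z : ℂ) (hz1 : 0 < z.re) (hz2 : z.re < 1) :
    (1 / (Real.pi : ℂ)) * ∫ t in Set.Ioi (0 : ℝ),
        (∫ ν : ℝ, (E (ν / lam) : ℂ) * Complex.exp (-(Complex.I * ν * t))) * (t : ℂ) ^ (-z)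
      = (2 / (Real.pi : ℂ)) * (lam : ℂ) ^ z * Complex.Gamma (1 - z)
          * Complex.sin ((Real.pi : ℂ) * z / 2)
          * ∫ ν in (0 : ℝ)..1, (E ν : ℂ) * (ν : ℂ) ^ (z - 1) := by
  have hEcont : Continuous E := by
    rw [funext hAC]
    exact continuous_const.add
      (intervalIntegral.continuous_primitive (fun _ _ => hg.intervalIntegrable) 0)
  have hzero {x : ℝ} (hx : 1 < |x|) : E x = 0 := by
    by_contra h
    exact absurd (abs_le.mpr (hSupp h)) (not_le.mpr hx)
  have hscale (x : ℝ) : E (x / lam) = 1 + ∫ t in (0 : ℝ)..x, lam⁻¹ * g (t / lam) := by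
    rw [intervalIntegral.integral_const_mul, intervalIntegral.inv_mul_integral_comp_div, zero_div,
      hAC, hE0]
  have hzero' {x : ℝ} (hx : lam < |x|) : E (x / lam) = 0 := by
    apply hzero
    rwa [abs_div, abs_of_pos hlam, one_lt_div hlam]
  have hAC' : AbsolutelyContinuousOnInterval (fun x => E (x / lam)) (-(2 * lam)) (2 * lam) := by
    rw [funext hscale]
    have hgi : IntervalIntegrable (fun t => lam⁻¹ * g (t / lam)) volume (-(2 * lam)) (2 * lam) :=
      ((hg.comp_div hlam.ne').const_mul _).intervalIntegrable
    refine AbsolutelyContinuousOnInterval.fun_add ?_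
      (hgi.absolutelyContinuousOnInterval_intervalIntegral ?_)
    · exact (contDiff_const (n := 1)).contDiffOn.absolutelyContinuousOnInterval
    · rw [uIcc_of_le (by linarith)]
      constructor <;> linarith
  have hsupp' : Function.support (fun x => E (x / lam)) ⊆ Ioc (-(2 * lam)) (2 * lam) := by
    intro x hx
    have : |x| ≤ lam := by
      by_contra! h
      exact hx (hzero' h)
    rw [abs_le] at this
    constructor <;> linarith
  have hdecay := fun (t : ℝ) (ht : 0 < t) => norm_integral_mul_cexp_le_of_absolutelyContinuous
    (by linarith) hAC' (hzero' (by rw [abs_neg, abs_of_pos] <;> linarith))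
    (hzero' (by rw [abs_of_pos] <;> linarith)) hsupp' ht
  have hcompact : HasCompactSupport fun ν : ℝ => (E (ν / lam) : ℂ) := by
    refine HasCompactSupport.intro (isCompact_Icc (a := -(2 * lam)) (b := 2 * lam)) fun x hx => ?_
    have : x ∉ Function.support (fun x => E (x / lam)) :=
      fun h => hx (Ioc_subset_Icc_self (hsupp' h))
    simpa using this
  rw [integral_fourier_mul_cpow (f := fun ν : ℝ => (E (ν / lam) : ℂ)) (by fun_prop) hcompact
    (fun ν => by rw [neg_div, hEven]) hdecay hz1 hz2]
  have hchange : ∫ ν in Ioi (0 : ℝ), (E (ν / lam) : ℂ) * (ν : ℂ) ^ (z - 1)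
      = (lam : ℂ) ^ z * ∫ ν in (0 : ℝ)..1, (E ν : ℂ) * (ν : ℂ) ^ (z - 1) := by
    have hlam0 : (lam : ℂ) ≠ 0 := by exact_mod_cast hlam.ne'
    have h := integral_comp_mul_left_Ioi
      (fun ν : ℝ => (E (ν / lam) : ℂ) * (ν : ℂ) ^ (z - 1)) 0 hlam
    rw [mul_zero, eq_inv_smul_iff₀ hlam.ne'] at h
    rw [← h, intervalIntegral.integral_of_le zero_le_one,
      setIntegral_eq_of_subset_of_forall_sdiff_eq_zero measurableSet_Ioi
        (Ioc_subset_Ioi_self : Ioc (0 : ℝ) 1 ⊆ Ioi 0), Complex.real_smul, ← integral_const_mul,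
      ← integral_const_mul]
    · refine setIntegral_congr_fun measurableSet_Ioc fun ν hν => ?_
      simp only [mul_div_cancel_left₀ ν hlam.ne']
      rw [Complex.ofReal_mul, Complex.mul_cpow_ofReal_nonneg hlam.le hν.1.le,
        Complex.cpow_sub _ _ hlam0, Complex.cpow_one]
      field_simp
    · intro ν hν
      have h1 : 1 < |ν| := by
        have h0 : 0 < ν := hν.1
        by_contra! hle
        exact hν.2 ⟨h0, (le_abs_self ν).trans hle⟩
      simp [mul_div_cancel_left₀ ν hlam.ne', hzero h1]
  rw [hchange]
  ring
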